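/- Let M ≥ 1, K ≥ 1, let μ₁,…,μ_M ∈ ℝ, σ₁,…,σ_M > 0, let (μ_{0,1},σ_{0,1}),…,(μ_{0,K},σ_{0,K}) ∈ ℝ × (0,∞), let (p₁,…,p_K) ∈ Δ_K, and let f₀(y) = Σ_{i=1}^K p_i φ(y|μ_{0,i},σ_{0,i}²) be a finite Gaussian mixture. Then for every ω* = (ω*₁,…,ω*_M) in the interior of Δ_M, with h(y|ω*) = Σ_{m=1}^M ω*_m φ(y|μ_m,σ_m²) and H(y|ω*) = Σ_{m=1}^M ω*_m Φ(y|μ_m,σ_m²), one has ∫_ℝ [|log(H(y|ω*))| + |log(1−H(y|ω*))|] f₀(y) dy < +∞ and KL(f₀, h(·|ω*)) < +∞. -/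

import Mathlib

open MeasureTheory Set

/-- Density `φ(y|μ,σ²)` of the normal distribution with mean `μ` and variance `σ2`. -/
noncomputable def gaussDensity (μ σ2 y : ℝ) : ℝ :=
  (Real.sqrt (2 * Real.pi * σ2))⁻¹ * Real.exp (-((y - μ) ^ 2) / (2 * σ2))

/-- Cdf `Φ(y|μ,σ²)` of the normal distribution with mean `μ` and variance `σ2`. -/
noncomputable def gaussCdf (μ σ2 y : ℝ) : ℝ := ∫ z in Iic y, gaussDensity μ σ2 z

lemma gaussDensity_eq_gaussianPDFReal (m : ℝ) {s : ℝ} (hs : 0 < s) :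
    gaussDensity m s = ProbabilityTheory.gaussianPDFReal m s.toNNReal := by
  ext y
  simp [gaussDensity, ProbabilityTheory.gaussianPDFReal, Real.coe_toNNReal _ hs.le]

lemma gaussDensity_nonneg (m s y : ℝ) : 0 ≤ gaussDensity m s y := by
  unfold gaussDensity; positivity

lemma continuous_gaussDensity (m s : ℝ) : Continuous (gaussDensity m s) := by
  unfold gaussDensity; fun_prop

lemma integrable_gaussDensity (m : ℝ) {s : ℝ} (hs : 0 < s) : Integrable (gaussDensity m s) := by
  rw [gaussDensity_eq_gaussianPDFReal m hs]
  exact ProbabilityTheory.integrable_gaussianPDFReal _ _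

lemma integral_gaussDensity (m : ℝ) {s : ℝ} (hs : 0 < s) : ∫ y, gaussDensity m s y = 1 := by
  rw [gaussDensity_eq_gaussianPDFReal m hs]
  exact ProbabilityTheory.integral_gaussianPDFReal_eq_one _ (by simpa using hs)

lemma integrable_sq_mul_gaussDensity (m : ℝ) {s : ℝ} (hs : 0 < s) :
    Integrable fun y => y ^ 2 * gaussDensity m s y := by
  have hv : s.toNNReal ≠ 0 := by simpa using hs
  have h := (ProbabilityTheory.memLp_id_gaussianReal (μ := m) (v := s.toNNReal) 2).integrable_sq
  rw [ProbabilityTheory.gaussianReal_of_var_ne_zero _ hv, integrable_withDensity_iff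
    (ProbabilityTheory.measurable_gaussianPDF _ _)
    (ae_of_all _ fun _ => ProbabilityTheory.gaussianPDF_lt_top)] at h
  simpa [gaussDensity_eq_gaussianPDFReal m hs, ProbabilityTheory.toReal_gaussianPDF] using h

/-- A Gaussian minorant of the normal density, uniform over unit neighbourhoods. -/
lemma exists_le_gaussDensity (m : ℝ) {s : ℝ} (hs : 0 < s) :
    ∃ C > 0, ∃ a, 0 ≤ a ∧
      ∀ y z, |z - y| ≤ 1 → C * Real.exp (-(a * y ^ 2)) ≤ gaussDensity m s z := by
  refine ⟨(Real.sqrt (2 * Real.pi * s))⁻¹ * Real.exp (-((1 + |m|) ^ 2 / s)), by positivity,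
    1 / s, by positivity, fun y z h => ?_⟩
  rw [gaussDensity, mul_assoc, ← Real.exp_add]
  gcongr
  have h1 : (z - y - m) ^ 2 ≤ (1 + |m|) ^ 2 :=
    sq_le_sq' (by linarith [(abs_le.1 h).1, le_abs_self m])
      (by linarith [(abs_le.1 h).2, neg_abs_le m])
  have h2 : (z - m) ^ 2 ≤ 2 * ((1 + |m|) ^ 2 + y ^ 2) := by
    nlinarith [sq_nonneg (z - y - m - y)]
  rw [neg_div, show -((1 + |m|) ^ 2 / s) + -(1 / s * y ^ 2) =
    -(2 * ((1 + |m|) ^ 2 + y ^ 2) / (2 * s)) by field_simp; ring]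
  gcongr

lemma gaussCdf_nonneg (m s y : ℝ) : 0 ≤ gaussCdf m s y :=
  integral_nonneg fun _ => gaussDensity_nonneg _ _ _

lemma one_sub_gaussCdf (m : ℝ) {s : ℝ} (hs : 0 < s) (y : ℝ) :
    1 - gaussCdf m s y = ∫ z in Ioi y, gaussDensity m s z := by
  have hi := integrable_gaussDensity m hs
  rw [← integral_gaussDensity m hs, gaussCdf,
    ← intervalIntegral.integral_Iic_add_Ioi (b := y) hi.integrableOn hi.integrableOn]
  ring

lemma gaussCdf_le_one (m : ℝ) {s : ℝ} (hs : 0 < s) (y : ℝ) : gaussCdf m s y ≤ 1 := by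
  rw [← sub_nonneg, one_sub_gaussCdf m hs]
  exact integral_nonneg fun _ => gaussDensity_nonneg _ _ _

lemma measurable_gaussCdf (m : ℝ) {s : ℝ} (hs : 0 < s) : Measurable (gaussCdf m s) := by
  refine Monotone.measurable fun x y hxy => ?_
  exact setIntegral_mono_set (integrable_gaussDensity m hs).integrableOn
    (ae_of_all _ fun _ => gaussDensity_nonneg _ _ _) (Iic_subset_Iic.2 hxy).eventuallyLE

/-- A lower bound for the density on a unit interval inside `t` bounds the mass of `t`. -/
lemma le_setIntegral_gaussDensity (m : ℝ) {s : ℝ} (hs : 0 < s) {t : Set ℝ} {b c : ℝ}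
    (ht : Ioc b (b + 1) ⊆ t) (h : ∀ z ∈ Ioc b (b + 1), c ≤ gaussDensity m s z) :
    c ≤ ∫ z in t, gaussDensity m s z := by
  have hi := integrable_gaussDensity m hs
  calc c = ∫ _ in Ioc b (b + 1), c := by simp
    _ ≤ ∫ z in Ioc b (b + 1), gaussDensity m s z :=
      setIntegral_mono_on (by simp) hi.integrableOn measurableSet_Ioc h
    _ ≤ _ := setIntegral_mono_set hi.integrableOn
      (ae_of_all _ fun _ => gaussDensity_nonneg _ _ _) ht.eventuallyLE

/-- A bounded function with a Gaussian-type positive minorant. -/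
def HasGaussianMinorant (f : ℝ → ℝ) : Prop :=
  ∃ C > 0, ∃ a, 0 ≤ a ∧ ∃ D, ∀ y, C * Real.exp (-(a * y ^ 2)) ≤ f y ∧ f y ≤ D

lemma HasGaussianMinorant.pos {f : ℝ → ℝ} (hf : HasGaussianMinorant f) (y : ℝ) : 0 < f y := by
  obtain ⟨C, hC, a, -, D, h⟩ := hf
  exact lt_of_lt_of_le (by positivity) (h y).1

lemma HasGaussianMinorant.sum {ι : Type*} [Fintype ι] {w : ι → ℝ} {f : ι → ℝ → ℝ}
    (hw : w ∈ stdSimplex ℝ ι) (hf : ∀ i, HasGaussianMinorant (f i)) :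
    HasGaussianMinorant fun y => ∑ i, w i * f i y := by
  have hpos : ∃ j, 0 < w j := by
    by_contra! h
    linarith [hw.2, Finset.sum_nonpos fun i (_ : i ∈ Finset.univ) => h i]
  obtain ⟨j, hj⟩ := hpos
  have hf0 := fun i => (hf i).pos
  choose C hC a ha D h using hf
  refine ⟨w j * C j, mul_pos hj (hC j), a j, ha j, ∑ i, w i * D i, fun y => ⟨?_, ?_⟩⟩
  · calc w j * C j * Real.exp (-(a j * y ^ 2)) ≤ w j * f j y := by
          rw [mul_assoc]; exact mul_le_mul_of_nonneg_left (h j y).1 hj.le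
      _ ≤ _ := Finset.single_le_sum (f := fun i => w i * f i y)
          (fun i _ => mul_nonneg (hw.1 i) (hf0 i y).le) (Finset.mem_univ j)
  · exact Finset.sum_le_sum fun i _ => mul_le_mul_of_nonneg_left (h i y).2 (hw.1 i)

lemma HasGaussianMinorant.abs_log_le {f : ℝ → ℝ} (hf : HasGaussianMinorant f) :
    ∃ A a, ∀ y, |Real.log (f y)| ≤ A + a * y ^ 2 := by
  have hf0 := hf.pos
  obtain ⟨C, hC, a, ha, D, h⟩ := hf
  refine ⟨|Real.log C| + |Real.log D|, a, fun y => abs_le.2 ⟨?_, ?_⟩⟩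
  · have h1 := Real.log_le_log (by positivity) (h y).1
    rw [Real.log_mul hC.ne' (Real.exp_ne_zero _), Real.log_exp] at h1
    linarith [neg_abs_le (Real.log C), abs_nonneg (Real.log D)]
  · have h1 := Real.log_le_log (hf0 y) (h y).2
    have : 0 ≤ a * y ^ 2 := by positivity
    linarith [le_abs_self (Real.log D), abs_nonneg (Real.log C)]

lemma HasGaussianMinorant.integrable_abs_log_mul {f g : ℝ → ℝ} (hf : HasGaussianMinorant f)
    (hfm : Measurable f) (hg0 : ∀ y, 0 ≤ g y) (hg : Integrable g)
    (hg2 : Integrable fun y => y ^ 2 * g y) : Integrable fun y => |Real.log (f y)| * g y := by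
  obtain ⟨A, a, h⟩ := hf.abs_log_le
  refine ((hg.const_mul A).add (hg2.const_mul a)).mono'
    ((hfm.log.abs.aestronglyMeasurable).mul hg.1) (ae_of_all _ fun y => ?_)
  rw [Real.norm_of_nonneg (mul_nonneg (abs_nonneg _) (hg0 y))]
  calc |Real.log (f y)| * g y ≤ (A + a * y ^ 2) * g y :=
        mul_le_mul_of_nonneg_right (h y) (hg0 y)
    _ = _ := by simp only [Pi.add_apply]; ring

lemma hasGaussianMinorant_gaussDensity (m : ℝ) {s : ℝ} (hs : 0 < s) :
    HasGaussianMinorant (gaussDensity m s) := by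
  obtain ⟨C, hC, a, ha, h⟩ := exists_le_gaussDensity m hs
  refine ⟨C, hC, a, ha, (Real.sqrt (2 * Real.pi * s))⁻¹, fun y => ⟨h y y (by simp), ?_⟩⟩
  refine mul_le_of_le_one_right (by positivity) (Real.exp_le_one_iff.2 ?_)
  exact div_nonpos_of_nonpos_of_nonneg (neg_nonpos.2 (sq_nonneg _)) (by positivity)

lemma hasGaussianMinorant_gaussCdf (m : ℝ) {s : ℝ} (hs : 0 < s) :
    HasGaussianMinorant (gaussCdf m s) := by
  obtain ⟨C, hC, a, ha, h⟩ := exists_le_gaussDensity m hs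
  refine ⟨C, hC, a, ha, 1, fun y => ⟨?_, gaussCdf_le_one m hs y⟩⟩
  refine le_setIntegral_gaussDensity m hs (b := y - 1) (fun z hz => ?_) fun z hz => h y z ?_
  · simpa using hz.2
  · rw [abs_le]; constructor <;> linarith [hz.1, hz.2]

lemma hasGaussianMinorant_one_sub_gaussCdf (m : ℝ) {s : ℝ} (hs : 0 < s) :
    HasGaussianMinorant fun y => 1 - gaussCdf m s y := by
  obtain ⟨C, hC, a, ha, h⟩ := exists_le_gaussDensity m hs
  refine ⟨C, hC, a, ha, 1, fun y => ⟨?_, by linarith [gaussCdf_nonneg m s y]⟩⟩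
  beta_reduce
  rw [one_sub_gaussCdf m hs]
  refine le_setIntegral_gaussDensity m hs (b := y) (fun z hz => hz.1) fun z hz => h y z ?_
  rw [abs_le]; constructor <;> linarith [hz.1, hz.2]

/-- Example 2 (mixture of normals): the entropy conditions of Theorem 1 hold
when the true density is a finite Gaussian mixture and ω* is interior to Δ_M. -/
theorem gaussian_mixture_entropy_conditions
    (M K : ℕ) (hM : 0 < M) (hK : 0 < K)
    (μ : Fin M → ℝ) (σ : Fin M → ℝ) (hσ : ∀ m, 0 < σ m)
    (μ₀ : Fin K → ℝ) (σ₀ : Fin K → ℝ) (hσ₀ : ∀ i, 0 < σ₀ i)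
    (p : Fin K → ℝ) (hp : p ∈ stdSimplex ℝ (Fin K))
    (ωs : Fin M → ℝ) (hωs : ωs ∈ stdSimplex ℝ (Fin M)) (hωs_pos : ∀ m, 0 < ωs m) :
    Integrable (fun y =>
      (|Real.log (∑ m, ωs m * gaussCdf (μ m) (σ m ^ 2) y)| +
        |Real.log (1 - ∑ m, ωs m * gaussCdf (μ m) (σ m ^ 2) y)|) *
        ∑ i, p i * gaussDensity (μ₀ i) (σ₀ i ^ 2) y) ∧
    Integrable (fun y => (∑ i, p i * gaussDensity (μ₀ i) (σ₀ i ^ 2) y) *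
      Real.log ((∑ i, p i * gaussDensity (μ₀ i) (σ₀ i ^ 2) y) /
        ∑ m, ωs m * gaussDensity (μ m) (σ m ^ 2) y)) := by
  have hv : ∀ m, 0 < σ m ^ 2 := fun m => pow_pos (hσ m) 2
  have hv₀ : ∀ i, 0 < σ₀ i ^ 2 := fun i => pow_pos (hσ₀ i) 2
  have hf := HasGaussianMinorant.sum hp fun i => hasGaussianMinorant_gaussDensity (μ₀ i) (hv₀ i)
  have hh := HasGaussianMinorant.sum hωs fun m => hasGaussianMinorant_gaussDensity (μ m) (hv m)
  have hH := HasGaussianMinorant.sum hωs fun m => hasGaussianMinorant_gaussCdf (μ m) (hv m)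
  have hH' := HasGaussianMinorant.sum hωs fun m =>
    hasGaussianMinorant_one_sub_gaussCdf (μ m) (hv m)
  simp only [mul_sub, mul_one, Finset.sum_sub_distrib, hωs.2] at hH'
  have hHm : Measurable fun y => ∑ m, ωs m * gaussCdf (μ m) (σ m ^ 2) y :=
    Finset.measurable_fun_sum _ fun m _ => (measurable_gaussCdf (μ m) (hv m)).const_mul _
  have hhm : Measurable fun y => ∑ m, ωs m * gaussDensity (μ m) (σ m ^ 2) y :=
    Finset.measurable_fun_sum _ fun m _ => (continuous_gaussDensity _ _).measurable.const_mul _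
  have hfm : Measurable fun y => ∑ i, p i * gaussDensity (μ₀ i) (σ₀ i ^ 2) y :=
    Finset.measurable_fun_sum _ fun i _ => (continuous_gaussDensity _ _).measurable.const_mul _
  have hfi : Integrable fun y => ∑ i, p i * gaussDensity (μ₀ i) (σ₀ i ^ 2) y :=
    integrable_finsetSum _ fun i _ => (integrable_gaussDensity _ (hv₀ i)).const_mul _
  have hfi2 : Integrable fun y => y ^ 2 * ∑ i, p i * gaussDensity (μ₀ i) (σ₀ i ^ 2) y := by
    simp only [Finset.mul_sum, mul_left_comm]
    exact integrable_finsetSum _ fun i _ =>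
      (integrable_sq_mul_gaussDensity _ (hv₀ i)).const_mul _
  have hf0 := fun y => (hf.pos y).le
  refine ⟨?_, ?_⟩
  · simp only [add_mul]
    exact (hH.integrable_abs_log_mul hHm hf0 hfi hfi2).add
      (hH'.integrable_abs_log_mul (hHm.const_sub 1) hf0 hfi hfi2)
  · refine ((hf.integrable_abs_log_mul hfm hf0 hfi hfi2).add
      (hh.integrable_abs_log_mul hhm hf0 hfi hfi2)).mono'
      (hfm.mul (hfm.div hhm).log).aestronglyMeasurable (ae_of_all _ fun y => ?_)
    rw [Real.log_div (hf.pos y).ne' (hh.pos y).ne', norm_mul, Real.norm_of_nonneg (hf0 y),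
      mul_comm, Pi.add_apply, ← add_mul]
    exact mul_le_mul_of_nonneg_right (abs_sub _ _) (hf0 y)
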